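/- arXiv:2602.05976 — 2 statements merged into one kernel-verified Lean document; each statement's English description precedes it below -/
import Mathlib

section
/- Under assumptions (A1)–(A3) on the cost c and the open sets X, Y, the barycenter functional B is coercive over P_cost(Y) (for every β ∈ ℝ there is a constant C_β such that every ν ∈ P_cost(Y) with B(ν) ≤ β satisfies ∫_Y c(x0,y) dν(y) ≤ C_β, so the lower level sets {ν ∈ P_cost(Y) : B(ν) ≤ β} are weakly sequentially precompact in the space of probability measures on Y with all limit points in P_cost(Y)), B is sequentially lower semicontinuous with respect to weak convergence of measures on its lower level sets, and consequently there exists a signed barycenter ν̄ ∈ P_cost(Y) minimizing B over P_cost(Y). -/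
open MeasureTheory Filter Set Topology
open scoped ENNReal BigOperators RealInnerProductSpace

noncomputable section

abbrev Euc (d : ℕ) : Type := EuclideanSpace ℝ (Fin d)

/-- `π` is a coupling of `μ` and `ν`. -/
def IsCoupling {d : ℕ} (π : Measure (Euc d × Euc d)) (μ ν : Measure (Euc d)) : Prop :=
  π.map Prod.fst = μ ∧ π.map Prod.snd = ν

/-- The optimal transport cost between `μ` and `ν` for the cost `c`. -/
def transportCost {d : ℕ} (c : Euc d → Euc d → ℝ) (μ ν : Measure (Euc d)) : ℝ :=
  (⨅ π : {π : Measure (Euc d × Euc d) // IsCoupling π μ ν},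
      ∫⁻ p, ENNReal.ofReal (c p.1 p.2) ∂(π.1)).toReal

/-- Probability measures supported on `S` with finite cost integral `∫ c₀`. -/
def memPcost {d : ℕ} (c₀ : Euc d → ℝ) (S : Set (Euc d)) (μ : Measure (Euc d)) : Prop :=
  IsProbabilityMeasure μ ∧ μ Sᶜ = 0 ∧ ∫⁻ x, ENNReal.ofReal (c₀ x) ∂μ < ⊤

/-- The signed barycenter (primal) functional. -/
def barycenterFun {d m : ℕ} (c : Euc d → Euc d → ℝ) (a : Fin m → ℝ)
    (μs : Fin m → Measure (Euc d)) (ν : Measure (Euc d)) : ℝ :=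
  ∑ i, a i * transportCost c (μs i) ν

/-- The c-transform of `f : Y → ℝ`, a function on `X`. -/
def ctransOnY {d : ℕ} (c : Euc d → Euc d → ℝ) (Y : Set (Euc d)) (f : Euc d → ℝ)
    (x : Euc d) : ℝ :=
  ⨅ y : Y, (c x y - f y)

/-- The c-transform of `g : X → ℝ`, a function on `Y`. -/
def ctransOnX {d : ℕ} (c : Euc d → Euc d → ℝ) (X : Set (Euc d)) (g : Euc d → ℝ)
    (y : Euc d) : ℝ :=
  ⨅ x : X, (c x y - g x)

/-- `f` is c-concave as a function on `Y`. -/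
def CConcaveOnY {d : ℕ} (c : Euc d → Euc d → ℝ) (X Y : Set (Euc d)) (f : Euc d → ℝ) : Prop :=
  ∃ g : Euc d → ℝ, ∀ y ∈ Y, f y = ctransOnX c X g y

/-- `g` is c-concave as a function on `X`. -/
def CConcaveOnX {d : ℕ} (c : Euc d → Euc d → ℝ) (X Y : Set (Euc d)) (g : Euc d → ℝ) : Prop :=
  ∃ f : Euc d → ℝ, ∀ x ∈ X, g x = ctransOnY c Y f x

/-- Assumptions (A1)–(A3) on the cost. -/
structure CostAssumptions (d : ℕ) (X Y : Set (Euc d)) (c : Euc d → Euc d → ℝ)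
    (x0 y0 : Euc d) : Prop where
  openX : IsOpen X
  openY : IsOpen Y
  nonneg : ∀ x ∈ X, ∀ y ∈ Y, 0 ≤ c x y
  smooth : ContDiffOn ℝ 2 (fun p : Euc d × Euc d => c p.1 p.2) (X ×ˢ Y)
  twistX : ∀ x ∈ X, Set.InjOn (fun y => gradient (fun x' => c x' y) x) Y
  twistY : ∀ y ∈ Y, Set.InjOn (fun x => gradient (fun y' => c x y') y) X
  compactX : ∀ (b : ℝ), ∀ y' ∈ Y, IsCompact {x ∈ X | c x y' ≤ b}
  compactY : ∀ (b : ℝ), ∀ x' ∈ X, IsCompact {y ∈ Y | c x' y ≤ b}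
  x0mem : x0 ∈ X
  y0mem : y0 ∈ Y
  growth : ∀ ε : ℝ, 0 < ε → ∃ B : ℝ, 0 < B ∧ ∀ x ∈ X, ∀ y ∈ Y,
      ((1 - ε) * c x0 y - B * c x y0 ≤ c x y ∧ c x y ≤ (1 + ε) * c x0 y + B * c x y0) ∧
      ((1 - ε) * c x y0 - B * c x0 y ≤ c x y ∧ c x y ≤ (1 + ε) * c x y0 + B * c x0 y)

/-- Weak convergence of a sequence of measures (in duality with bounded continuous functions). -/
def WeakLimit {d : ℕ} (νs : ℕ → Measure (Euc d)) (ν : Measure (Euc d)) : Prop :=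
  ∀ g : BoundedContinuousFunction (Euc d) ℝ,
    Tendsto (fun n => ∫ y, g y ∂(νs n)) atTop (𝓝 (∫ y, g y ∂ν))

section Coupling

open ProbabilityTheory

/-- Gluing of two couplings along their common marginal. -/
lemma exists_gluing {E : Type*} [MeasurableSpace E] [StandardBorelSpace E] [Nonempty E]
    (π γ : Measure (E × E)) [IsProbabilityMeasure π] [IsProbabilityMeasure γ]
    (h : π.map Prod.snd = γ.map Prod.fst) :
    ∃ Γ : Measure (E × E × E), Γ.map (fun p => (p.2.1, p.1)) = π ∧
      Γ.map (fun p => (p.1, p.2.2)) = γ := by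
  set π' := π.map Prod.swap with hπ'
  have : IsProbabilityMeasure π' := Measure.isProbabilityMeasure_map (by fun_prop)
  have hfst : π'.fst = γ.fst := by
    rw [Measure.fst, Measure.fst, ← h, hπ', Measure.map_map (by fun_prop) (by fun_prop)]
    rfl
  have h1 : π'.fst ⊗ₘ π'.condKernel = π' := π'.disintegrate _
  have h2 : γ.fst ⊗ₘ γ.condKernel = γ := γ.disintegrate _
  refine ⟨γ.fst ⊗ₘ (π'.condKernel ×ₖ γ.condKernel), ?_, ?_⟩
  · have : (γ.fst ⊗ₘ (π'.condKernel ×ₖ γ.condKernel)).map (Prod.map id Prod.fst) = π' := by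
      rw [← Measure.compProd_map measurable_fst, ← Kernel.fst_eq, Kernel.fst_prod, ← hfst, h1]
    have hπ : π = π'.map Prod.swap := by
      rw [hπ', Measure.map_map (by fun_prop) (by fun_prop)]
      simp
    refine Eq.trans ?_ hπ.symm
    refine Eq.trans ?_ (congrArg (Measure.map Prod.swap) this)
    rw [Measure.map_map (by fun_prop) (by fun_prop)]
    rfl
  · have : (γ.fst ⊗ₘ (π'.condKernel ×ₖ γ.condKernel)).map (Prod.map id Prod.snd) = γ := by
      rw [← Measure.compProd_map measurable_snd, ← Kernel.snd_eq, Kernel.snd_prod, h2]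
    exact this

/-- A subcoupling of two probability measures extends to a coupling. -/
lemma exists_coupling_ge {E : Type*} [MeasurableSpace E]
    (θ : Measure (E × E)) [IsFiniteMeasure θ] (ν ν' : Measure E) [IsProbabilityMeasure ν]
    [IsProbabilityMeasure ν'] (h1 : θ.map Prod.fst ≤ ν) (h2 : θ.map Prod.snd ≤ ν') :
    ∃ γ : Measure (E × E), γ.map Prod.fst = ν ∧ γ.map Prod.snd = ν' ∧
      ∀ s, γ s ≤ θ s + (1 - θ univ) := by
  have hu1 : (ν - θ.map Prod.fst) univ = 1 - θ univ := by
    rw [Measure.sub_apply MeasurableSet.univ h1, Measure.map_apply measurable_fst .univ]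
    simp
  have hu2 : (ν' - θ.map Prod.snd) univ = 1 - θ univ := by
    rw [Measure.sub_apply MeasurableSet.univ h2, Measure.map_apply measurable_snd .univ]
    simp
  have hne : 1 - θ univ ≠ ⊤ := ENNReal.sub_ne_top ENNReal.one_ne_top
  set r := (1 - θ univ) with hr
  have key : ∀ ρ : Measure E, ρ univ = r → (r⁻¹ * r) • ρ = ρ := by
    intro ρ hρ
    by_cases h0 : r = 0
    · have : ρ = 0 := by rw [← Measure.measure_univ_eq_zero, hρ, h0]
      simp [this]
    · rw [ENNReal.inv_mul_cancel h0 hne, one_smul]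
  refine ⟨θ + r⁻¹ • (ν - θ.map Prod.fst).prod (ν' - θ.map Prod.snd), ?_, ?_, fun s => ?_⟩
  · rw [Measure.map_add _ _ measurable_fst, Measure.map_smul, Measure.map_fst_prod, hu2,
      smul_smul, key _ hu1, add_comm, Measure.sub_add_cancel_of_le h1]
  · rw [Measure.map_add _ _ measurable_snd, Measure.map_smul, Measure.map_snd_prod, hu1,
      smul_smul, key _ hu2, add_comm, Measure.sub_add_cancel_of_le h2]
  · rw [Measure.add_apply]
    gcongr
    refine (measure_mono (subset_univ s)).trans ?_
    rw [Measure.smul_apply, ← univ_prod_univ, Measure.prod_prod, hu1, hu2, smul_eq_mul, ← mul_assoc]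
    exact mul_le_of_le_one_left zero_le (ENNReal.inv_mul_le_one _)

/-- Two probability measures have a coupling concentrated near the diagonal, up to the mass not
matched on disjoint small cells. -/
lemma exists_coupling_of_cells {E : Type*} [PseudoMetricSpace E] [MeasurableSpace E]
    (ν ν' : Measure E) [IsProbabilityMeasure ν] [IsProbabilityMeasure ν'] {δ : ℝ}
    (A : ℕ → Set E) (hA : ∀ j, MeasurableSet (A j)) (hdisj : Pairwise (Function.onFun Disjoint A))
    (hdiam : ∀ j, ∀ x ∈ A j, ∀ y ∈ A j, dist x y < δ) (s : Finset ℕ) :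
    ∃ γ : Measure (E × E), γ.map Prod.fst = ν ∧ γ.map Prod.snd = ν' ∧
      γ {p | δ ≤ dist p.1 p.2} ≤ 1 - ∑ j ∈ s, min (ν (A j)) (ν' (A j)) := by
  set w : ℕ → ℝ≥0∞ := fun j => min (ν (A j)) (ν' (A j)) with hw
  set k : ℕ → ℝ≥0∞ := fun j => w j * (ν (A j))⁻¹ * (ν' (A j))⁻¹ with hk
  set θ : Measure (E × E) :=
    ∑ j ∈ s, k j • (ν.restrict (A j)).prod (ν'.restrict (A j)) with hθ
  have hk1 : ∀ j, k j * ν' (A j) ≤ 1 := fun j => by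
    calc k j * ν' (A j) = (w j * (ν (A j))⁻¹) * ((ν' (A j))⁻¹ * ν' (A j)) := by
          simp only [hk]; ring
      _ ≤ (ν (A j) * (ν (A j))⁻¹) * 1 := by
          gcongr
          · exact min_le_left _ _
          · exact ENNReal.inv_mul_le_one _
      _ ≤ 1 := by rw [mul_one]; exact ENNReal.mul_inv_le_one _
  have hk2 : ∀ j, k j * ν (A j) ≤ 1 := fun j => by
    calc k j * ν (A j) = (w j * (ν' (A j))⁻¹) * ((ν (A j))⁻¹ * ν (A j)) := by
          simp only [hk]; ring
      _ ≤ (ν' (A j) * (ν' (A j))⁻¹) * 1 := by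
          gcongr
          · exact min_le_right _ _
          · exact ENNReal.inv_mul_le_one _
      _ ≤ 1 := by rw [mul_one]; exact ENNReal.mul_inv_le_one _
  have hsum : ∀ (ρ : Measure E) (t : ℕ → ℝ≥0∞), (∀ j, t j ≤ 1) →
      ∑ j ∈ s, t j • ρ.restrict (A j) ≤ ρ := by
    intro ρ t ht
    calc ∑ j ∈ s, t j • ρ.restrict (A j) ≤ ∑ j ∈ s, ρ.restrict (A j) := by
          refine Finset.sum_le_sum fun j _ => ?_
          refine Measure.le_iff.2 fun u _ => ?_
          rw [Measure.smul_apply, smul_eq_mul]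
          exact mul_le_of_le_one_left zero_le (ht j)
      _ = ρ.restrict (⋃ j ∈ s, A j) := by
          rw [Measure.restrict_biUnion_finset (hdisj.set_pairwise _) hA,
            Measure.sum_fintype, Finset.sum_coe_sort s (fun j => ρ.restrict (A j))]
      _ ≤ ρ := Measure.restrict_le_self
  have hmass : θ univ = ∑ j ∈ s, w j := by
    simp only [hθ, Measure.coe_finsetSum, Finset.sum_apply, Measure.smul_apply, smul_eq_mul]
    refine Finset.sum_congr rfl fun j _ => ?_
    rw [← univ_prod_univ, Measure.prod_prod, Measure.restrict_apply_univ,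
      Measure.restrict_apply_univ]
    by_cases h0 : ν (A j) = 0
    · simp [hk, hw, h0]
    by_cases h0' : ν' (A j) = 0
    · simp [hk, hw, h0']
    calc k j * (ν (A j) * ν' (A j))
        = w j * ((ν (A j))⁻¹ * ν (A j)) * ((ν' (A j))⁻¹ * ν' (A j)) := by
          simp only [hk]; ring
      _ = w j := by
          rw [ENNReal.inv_mul_cancel h0 (measure_ne_top _ _),
            ENNReal.inv_mul_cancel h0' (measure_ne_top _ _), mul_one, mul_one]
  have hfin : IsFiniteMeasure θ := ⟨by
    rw [hmass]
    exact ENNReal.sum_lt_top.2 fun j _ => (min_le_left _ _).trans_lt (measure_lt_top ν _)⟩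
  have hbad : θ {p | δ ≤ dist p.1 p.2} = 0 := by
    simp only [hθ, Measure.coe_finsetSum, Finset.sum_apply, Measure.smul_apply, smul_eq_mul]
    refine Finset.sum_eq_zero fun j _ => ?_
    rw [Measure.prod_restrict]
    have : (ν.prod ν').restrict (A j ×ˢ A j) {p | δ ≤ dist p.1 p.2} = 0 := by
      refine measure_mono_null (t := (A j ×ˢ A j)ᶜ) ?_ ?_
      · intro p hp hp'
        exact (hdiam j _ hp'.1 _ hp'.2).not_ge hp
      · rw [Measure.restrict_apply ((hA j).prod (hA j)).compl]
        simp
    rw [this, mul_zero]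
  obtain ⟨γ, g1, g2, g3⟩ := exists_coupling_ge θ ν ν' (by
      rw [hθ, Measure.map_finset_sum measurable_fst.aemeasurable]
      simp only [Measure.map_smul, Measure.map_fst_prod,
        Measure.restrict_apply_univ, smul_smul]
      exact hsum ν _ hk1) (by
      rw [hθ, Measure.map_finset_sum measurable_snd.aemeasurable]
      simp only [Measure.map_smul, Measure.map_snd_prod,
        Measure.restrict_apply_univ, smul_smul]
      exact hsum ν' _ hk2)
  refine ⟨γ, g1, g2, (g3 _).trans ?_⟩
  rw [hbad, zero_add, hmass]

/-- Weakly converging measures are coupled to their limit with small distance in probability. -/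
lemma eventually_exists_coupling {E : Type*} [PseudoMetricSpace E]
    [TopologicalSpace.SeparableSpace E] [MeasurableSpace E] [BorelSpace E]
    (νs : ℕ → ProbabilityMeasure E) (ν : ProbabilityMeasure E) (h : Tendsto νs atTop (𝓝 ν))
    {δ : ℝ} (hδ : 0 < δ) :
    ∀ᶠ n in atTop, ∃ γ : Measure (E × E), γ.map Prod.fst = (ν : Measure E) ∧
      γ.map Prod.snd = (νs n : Measure E) ∧
      γ {p | δ ≤ dist p.1 p.2} ≤ ENNReal.ofReal δ := by
  have hne : Nonempty E := by
    by_contra hE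
    rw [not_nonempty_iff] at hE
    have := measure_univ (μ := (ν : Measure E))
    simp [univ_eq_empty_iff.2 hE] at this
  have hr : ∀ k : ℕ, ∃ r ∈ Ioo (δ / 4) (δ / 2), (ν : Measure E)
      (frontier (Metric.thickening r {TopologicalSpace.denseSeq E k})) = 0 := fun k =>
    exists_null_frontier_thickening _ _ (by linarith)
  choose r hr hr0 using hr
  set B : ℕ → Set E := fun k => Metric.thickening (r k) {TopologicalSpace.denseSeq E k} with hB
  have hBm : ∀ k, MeasurableSet (B k) := fun k => Metric.isOpen_thickening.measurableSet
  have hBu : ⋃ k, B k = univ := by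
    refine eq_univ_of_forall fun x => ?_
    obtain ⟨k, hk⟩ := (TopologicalSpace.denseRange_denseSeq E).exists_dist_lt x
      (show 0 < δ / 4 by linarith)
    refine mem_iUnion.2 ⟨k, ?_⟩
    simp only [hB, Metric.thickening_singleton, Metric.mem_ball]
    exact hk.trans (hr k).1
  set A := disjointed B with hA
  have hAm : ∀ k, MeasurableSet (A k) := fun k => MeasurableSet.disjointed hBm k
  have hAd : Pairwise (Function.onFun Disjoint A) := disjoint_disjointed B
  have hA0 : ∀ k, (ν : Measure E) (frontier (A k)) = 0 := by
    intro k
    refine disjointedRec (p := fun s => (ν : Measure E) (frontier s) = 0) ?_ (hr0 k)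
    intro t i ht
    rw [sdiff_eq]
    exact null_frontier_inter ht (by rw [frontier_compl]; exact hr0 i)
  have hdiam : ∀ j, ∀ x ∈ A j, ∀ y ∈ A j, dist x y < δ := by
    intro j x hx y hy
    have hx := disjointed_subset B j hx
    have hy := disjointed_subset B j hy
    simp only [hB, Metric.thickening_singleton, Metric.mem_ball] at hx hy
    have := dist_triangle_right x y (TopologicalSpace.denseSeq E j)
    linarith [(hr j).2]
  have hsum : Tendsto (fun N => ∑ j ∈ Finset.range N, (ν : Measure E) (A j)) atTop (𝓝 1) := by
    have : ∑' j, (ν : Measure E) (A j) = 1 := by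
      rw [← measure_iUnion hAd hAm, hA, iUnion_disjointed, hBu, measure_univ]
    rw [← this]
    exact ENNReal.tendsto_nat_tsum _
  have hlt : 1 - ENNReal.ofReal δ < 1 :=
    ENNReal.sub_lt_self ENNReal.one_ne_top one_ne_zero (by simpa using hδ)
  obtain ⟨N, hN⟩ := (hsum.eventually (lt_mem_nhds hlt)).exists
  have hconv : Tendsto (fun n => ∑ j ∈ Finset.range N,
      min ((ν : Measure E) (A j)) ((νs n : Measure E) (A j))) atTop
      (𝓝 (∑ j ∈ Finset.range N, (ν : Measure E) (A j))) := by
    refine tendsto_finsetSum _ fun j _ => ?_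
    have := ProbabilityMeasure.tendsto_measure_of_null_frontier_of_tendsto' h (hA0 j)
    simpa using (tendsto_const_nhds (x := (ν : Measure E) (A j))).min this
  filter_upwards [hconv.eventually (lt_mem_nhds hN)] with n hn
  obtain ⟨γ, g1, g2, g3⟩ := exists_coupling_of_cells (ν : Measure E) (νs n : Measure E) A hAm hAd
    hdiam (Finset.range N)
  refine ⟨γ, g1, g2, g3.trans ?_⟩
  exact tsub_le_iff_tsub_le.1 hn.le

end Coupling

lemma memPcost.integrable {d : ℕ} {f : Euc d → ℝ} {S : Set (Euc d)} {μ : Measure (Euc d)}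
    (h : memPcost f S μ) (hS : IsOpen S) (hf : ContinuousOn f S) (h0 : ∀ x ∈ S, 0 ≤ f x) :
    Integrable f μ := by
  have hae : ∀ᵐ x ∂μ, x ∈ S := h.2.1
  refine ⟨?_, ?_⟩
  · rw [← Measure.restrict_eq_self_of_ae_mem hae]
    exact hf.aestronglyMeasurable hS.measurableSet
  · rw [hasFiniteIntegral_iff_ofReal (by filter_upwards [hae] with x hx using h0 x hx)]
    exact h.2.2

lemma MeasureTheory.MeasurePreserving.integrable_and_integral_comp {α β : Type*}
    [MeasurableSpace α] [MeasurableSpace β] {π : Measure α} {μ : Measure β} {f : α → β}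
    (hf : MeasurePreserving f π μ) {g : β → ℝ} (hg : Integrable g μ) :
    Integrable (fun x => g (f x)) π ∧ ∫ x, g (f x) ∂π = ∫ y, g y ∂μ := by
  refine ⟨hf.integrable_comp_of_integrable hg, ?_⟩
  rw [← hf.map_eq] at hg ⊢
  rw [integral_map hf.measurable.aemeasurable hg.aestronglyMeasurable]

namespace CostAssumptions

variable {d : ℕ} {X Y : Set (Euc d)} {c : Euc d → Euc d → ℝ} {x0 y0 : Euc d}

lemma continuousOn_left (hc : CostAssumptions d X Y c x0 y0) : ContinuousOn (fun y => c x0 y) Y :=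
  hc.smooth.continuousOn.comp (f := fun y => (x0, y)) (by fun_prop) fun _ hy => ⟨hc.x0mem, hy⟩

lemma continuousOn_right (hc : CostAssumptions d X Y c x0 y0) :
    ContinuousOn (fun x => c x y0) X :=
  hc.smooth.continuousOn.comp (f := fun x => (x, y0)) (by fun_prop) fun _ hx => ⟨hx, hc.y0mem⟩

lemma integrable_left (hc : CostAssumptions d X Y c x0 y0) {ν : Measure (Euc d)}
    (hν : memPcost (fun y => c x0 y) Y ν) : Integrable (fun y => c x0 y) ν :=
  hν.integrable hc.openY hc.continuousOn_left fun y hy => hc.nonneg _ hc.x0mem y hy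

lemma integrable_right (hc : CostAssumptions d X Y c x0 y0) {μ : Measure (Euc d)}
    (hμ : memPcost (fun x => c x y0) X μ) : Integrable (fun x => c x y0) μ :=
  hμ.integrable hc.openX hc.continuousOn_right fun x hx => hc.nonneg x hx _ hc.y0mem

lemma integral_left_nonneg (hc : CostAssumptions d X Y c x0 y0) {ν : Measure (Euc d)}
    (hν : memPcost (fun y => c x0 y) Y ν) : 0 ≤ ∫ y, c x0 y ∂ν := by
  have hae : ∀ᵐ y ∂ν, y ∈ Y := hν.2.1
  exact integral_nonneg_of_ae (by
    filter_upwards [hae] with y hy using hc.nonneg _ hc.x0mem _ hy)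

section Coupling

variable {π : Measure (Euc d × Euc d)} {μ ν : Measure (Euc d)}

lemma coupling_ae_mem (hμ : memPcost (fun x => c x y0) X μ)
    (hν : memPcost (fun y => c x0 y) Y ν) (hπ : IsCoupling π μ ν) :
    ∀ᵐ p ∂π, p.1 ∈ X ∧ p.2 ∈ Y := by
  have h1 : ∀ᵐ x ∂(π.map Prod.fst), x ∈ X := by rw [hπ.1]; exact hμ.2.1
  have h2 : ∀ᵐ y ∂(π.map Prod.snd), y ∈ Y := by rw [hπ.2]; exact hν.2.1
  exact (ae_of_ae_map measurable_fst.aemeasurable h1).and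
    (ae_of_ae_map measurable_snd.aemeasurable h2)

lemma integrable_cost (hc : CostAssumptions d X Y c x0 y0)
    (hμ : memPcost (fun x => c x y0) X μ) (hν : memPcost (fun y => c x0 y) Y ν)
    (hπ : IsCoupling π μ ν) : Integrable (fun p => c p.1 p.2) π := by
  have hae := coupling_ae_mem hμ hν hπ
  obtain ⟨B, -, hB⟩ := hc.growth 1 one_pos
  have i1 := (MeasurePreserving.integrable_and_integral_comp ⟨measurable_fst, hπ.1⟩
    (hc.integrable_right hμ)).1
  have i2 := (MeasurePreserving.integrable_and_integral_comp ⟨measurable_snd, hπ.2⟩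
    (hc.integrable_left hν)).1
  refine ((i2.const_mul (1 + 1)).add (i1.const_mul B)).mono' ?_ ?_
  · rw [← Measure.restrict_eq_self_of_ae_mem (s := X ×ˢ Y) hae]
    exact hc.smooth.continuousOn.aestronglyMeasurable
      (hc.openX.measurableSet.prod hc.openY.measurableSet)
  · filter_upwards [hae] with p hp
    rw [Real.norm_of_nonneg (hc.nonneg _ hp.1 _ hp.2)]
    exact (hB _ hp.1 _ hp.2).1.2

lemma lintegral_cost (hc : CostAssumptions d X Y c x0 y0)
    (hμ : memPcost (fun x => c x y0) X μ) (hν : memPcost (fun y => c x0 y) Y ν)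
    (hπ : IsCoupling π μ ν) :
    ∫⁻ p, ENNReal.ofReal (c p.1 p.2) ∂π = ENNReal.ofReal (∫ p, c p.1 p.2 ∂π) := by
  rw [ofReal_integral_eq_lintegral_ofReal (hc.integrable_cost hμ hν hπ)]
  filter_upwards [coupling_ae_mem hμ hν hπ] with p hp using hc.nonneg _ hp.1 _ hp.2

lemma integral_cost_nonneg (hc : CostAssumptions d X Y c x0 y0)
    (hμ : memPcost (fun x => c x y0) X μ) (hν : memPcost (fun y => c x0 y) Y ν)
    (hπ : IsCoupling π μ ν) : 0 ≤ ∫ p, c p.1 p.2 ∂π :=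
  integral_nonneg_of_ae (by
    filter_upwards [coupling_ae_mem hμ hν hπ] with p hp using hc.nonneg _ hp.1 _ hp.2)

lemma transportCost_le (hc : CostAssumptions d X Y c x0 y0)
    (hμ : memPcost (fun x => c x y0) X μ) (hν : memPcost (fun y => c x0 y) Y ν)
    (hπ : IsCoupling π μ ν) : transportCost c μ ν ≤ ∫ p, c p.1 p.2 ∂π := by
  refine ENNReal.toReal_le_of_le_ofReal (hc.integral_cost_nonneg hμ hν hπ) ?_
  rw [← hc.lintegral_cost hμ hν hπ]
  exact iInf_le (fun π : {π : Measure (Euc d × Euc d) // IsCoupling π μ ν} =>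
    ∫⁻ p, ENNReal.ofReal (c p.1 p.2) ∂(π.1)) ⟨π, hπ⟩

end Coupling

variable {μ ν : Measure (Euc d)}

lemma exists_coupling_le (hc : CostAssumptions d X Y c x0 y0)
    (hμ : memPcost (fun x => c x y0) X μ) (hν : memPcost (fun y => c x0 y) Y ν)
    {ε : ℝ} (hε : 0 < ε) :
    ∃ π, IsCoupling π μ ν ∧ ∫ p, c p.1 p.2 ∂π ≤ transportCost c μ ν + ε := by
  have := hμ.1
  have := hν.1
  have hprod : IsCoupling (μ.prod ν) μ ν := by constructor <;> simp
  set I := ⨅ π : {π : Measure (Euc d × Euc d) // IsCoupling π μ ν},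
      ∫⁻ p, ENNReal.ofReal (c p.1 p.2) ∂(π.1)
  have hfin : I ≠ ⊤ := by
    refine ne_top_of_le_ne_top ?_ (iInf_le _ ⟨μ.prod ν, hprod⟩)
    rw [hc.lintegral_cost hμ hν hprod]
    exact ENNReal.ofReal_ne_top
  have hlt : I < I + ENNReal.ofReal ε := ENNReal.lt_add_right hfin (by simpa using hε)
  obtain ⟨⟨π, hπ⟩, h⟩ := iInf_lt_iff.1 hlt
  refine ⟨π, hπ, ?_⟩
  change _ < I + _ at h
  rw [hc.lintegral_cost hμ hν hπ] at h
  have hT : transportCost c μ ν = I.toReal := rfl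
  rw [← ENNReal.ofReal_toReal hfin, ← ENNReal.ofReal_add ENNReal.toReal_nonneg hε.le] at h
  rw [hT]
  exact ((ENNReal.ofReal_lt_ofReal_iff_of_nonneg (hc.integral_cost_nonneg hμ hν hπ)).1 h).le

/-- The transport cost differs from `∫ c x0 y` by a small fraction of the latter, up to a
constant depending only on the first marginal. -/
lemma abs_transportCost_sub_le (hc : CostAssumptions d X Y c x0 y0)
    (hμ : memPcost (fun x => c x y0) X μ) (hν : memPcost (fun y => c x0 y) Y ν)
    {η B : ℝ} (hB : ∀ x ∈ X, ∀ y ∈ Y, (1 - η) * c x0 y - B * c x y0 ≤ c x y ∧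
      c x y ≤ (1 + η) * c x0 y + B * c x y0) :
    |transportCost c μ ν - ∫ y, c x0 y ∂ν| ≤ η * ∫ y, c x0 y ∂ν + B * ∫ x, c x y0 ∂μ := by
  have key : ∀ π, IsCoupling π μ ν →
      |∫ p, c p.1 p.2 ∂π - ∫ y, c x0 y ∂ν| ≤ η * ∫ y, c x0 y ∂ν + B * ∫ x, c x y0 ∂μ := by
    intro π hπ
    have i1 := MeasurePreserving.integrable_and_integral_comp ⟨measurable_fst, hπ.1⟩
      (hc.integrable_right hμ)
    have i2 := MeasurePreserving.integrable_and_integral_comp ⟨measurable_snd, hπ.2⟩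
      (hc.integrable_left hν)
    rw [← i1.2, ← i2.2, ← integral_sub (hc.integrable_cost hμ hν hπ) i2.1, ← integral_const_mul,
      ← integral_const_mul, ← integral_add (i2.1.const_mul _) (i1.1.const_mul _)]
    refine abs_integral_le_integral_abs.trans (integral_mono_ae
      ((hc.integrable_cost hμ hν hπ).sub i2.1).abs ((i2.1.const_mul _).add (i1.1.const_mul _)) ?_)
    filter_upwards [coupling_ae_mem hμ hν hπ] with p hp
    have := hB _ hp.1 _ hp.2
    rw [abs_le]
    constructor <;> linarith [this.1, this.2]
  refine le_of_forall_pos_le_add fun ε hε => ?_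
  obtain ⟨π, hπ, hle⟩ := hc.exists_coupling_le hμ hν hε
  have h1 := hc.transportCost_le hμ hν hπ
  have h2 := abs_le.1 (key π hπ)
  rw [abs_le]
  constructor <;> linarith

end CostAssumptions

lemma MeasureTheory.MeasurePreserving.isProbabilityMeasure_domain {α β : Type*}
    [MeasurableSpace α] [MeasurableSpace β] {π : Measure α} {μ : Measure β} {f : α → β}
    (hf : MeasurePreserving f π μ) [IsProbabilityMeasure μ] : IsProbabilityMeasure π :=
  ⟨by rw [← preimage_univ (f := f), hf.measure_preimage MeasurableSet.univ.nullMeasurableSet,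
    measure_univ]⟩

namespace CostAssumptions

variable {d : ℕ} {X Y : Set (Euc d)} {c : Euc d → Euc d → ℝ} {x0 y0 : Euc d}

lemma exists_tail_le (hc : CostAssumptions d X Y c x0 y0) {μ : Measure (Euc d)}
    (hμ : memPcost (fun x => c x y0) X μ) {ε : ℝ} (hε : 0 < ε) :
    ∃ R : ℝ, 0 < R ∧ ∫ x, max (c x y0 - R) 0 ∂μ ≤ ε := by
  have hae : ∀ᵐ x ∂μ, x ∈ X := hμ.2.1
  have hi := hc.integrable_right hμ
  have hlim : Tendsto (fun n : ℕ => ∫ x, max (c x y0 - n) 0 ∂μ) atTop (𝓝 (∫ _, (0 : ℝ) ∂μ)) := by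
    refine tendsto_integral_of_dominated_convergence (fun x => c x y0) (fun n => ?_) hi
      (fun n => ?_) (Eventually.of_forall fun x => ?_)
    · have := hμ.1
      exact (hi.sub (integrable_const (n : ℝ))).pos_part.aestronglyMeasurable
    · filter_upwards [hae] with x hx
      have h0 := hc.nonneg x hx y0 hc.y0mem
      rw [Real.norm_of_nonneg (le_max_right _ _)]
      exact max_le (by linarith [n.cast_nonneg (α := ℝ)]) h0
    · refine tendsto_const_nhds.congr' ?_
      obtain ⟨N, hN⟩ := exists_nat_ge (c x y0)
      filter_upwards [eventually_ge_atTop N] with n hn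
      have : (N : ℝ) ≤ n := by exact_mod_cast hn
      rw [max_eq_right (by linarith)]
  rw [integral_zero] at hlim
  obtain ⟨n, hn, hn0⟩ := ((hlim.eventually (gt_mem_nhds hε)).and (eventually_gt_atTop 0)).exists
  exact ⟨n, by exact_mod_cast hn0, hn.le⟩

/-- The excess `K_c(μ, ν) - ∫ c x0 y dν` is uniformly continuous in `ν`, on sets of bounded cost
integral, with respect to closeness in probability under some coupling. -/
lemma exists_forall_excess_le (hc : CostAssumptions d X Y c x0 y0) {μ : Measure (Euc d)}
    (hμ : memPcost (fun x => c x y0) X μ) {C ε : ℝ} (hC : 0 < C) (hε : 0 < ε) :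
    ∃ δ : ℝ, 0 < δ ∧ ∀ (ν ν' : Measure (Euc d)) (γ : Measure (Euc d × Euc d)),
      memPcost (fun y => c x0 y) Y ν → memPcost (fun y => c x0 y) Y ν' →
      ∫ y, c x0 y ∂ν ≤ C → ∫ y, c x0 y ∂ν' ≤ C → IsCoupling γ ν ν' →
      γ {p | δ ≤ dist p.1 p.2} ≤ ENNReal.ofReal δ →
      transportCost c μ ν' - ∫ y, c x0 y ∂ν' ≤ transportCost c μ ν - ∫ y, c x0 y ∂ν + ε := by
  set η : ℝ := ε / (16 * C) with hη
  have hη0 : 0 < η := by positivity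
  obtain ⟨B, hB0, hB⟩ := hc.growth η hη0
  obtain ⟨R₁, hR₁0, hR₁⟩ := hc.exists_tail_le hμ (show 0 < ε / (32 * B) by positivity)
  set R : ℝ := 64 * B * R₁ * C / ε with hR
  have hR0 : 0 < R := by positivity
  set K : Set (Euc d × Euc d) := {x ∈ X | c x y0 ≤ 2 * R₁} ×ˢ {y ∈ Y | c x0 y ≤ R} with hK
  have hKc : IsCompact K := (hc.compactX _ _ hc.y0mem).prod (hc.compactY _ _ hc.x0mem)
  have hcont : ContinuousOn (fun p : Euc d × Euc d => c p.1 p.2 - c x0 p.2) K := by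
    refine (hc.smooth.continuousOn.mono ?_).sub (hc.continuousOn_left.comp continuousOn_snd ?_)
    · exact fun p hp => ⟨hp.1.1, hp.2.1⟩
    · exact fun p hp => hp.2.1
  obtain ⟨δ₀, hδ₀, huc⟩ := Metric.uniformContinuousOn_iff.1
    (hKc.uniformContinuousOn_of_continuous hcont) (ε / 8) (by positivity)
  set δ : ℝ := min δ₀ (ε / (32 * B * R₁)) with hδ
  have hδ0 : 0 < δ := lt_min hδ₀ (by positivity)
  refine ⟨δ, hδ0, fun ν ν' γ hν hν' hνC hν'C hγ hγδ => ?_⟩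
  obtain ⟨π, hπ, hπle⟩ := hc.exists_coupling_le hμ hν (show 0 < ε / 8 by positivity)
  have := hμ.1
  have := hν.1
  have : IsProbabilityMeasure π :=
    (MeasurePreserving.mk measurable_fst hπ.1).isProbabilityMeasure_domain
  have : IsProbabilityMeasure γ :=
    (MeasurePreserving.mk measurable_fst hγ.1).isProbabilityMeasure_domain
  obtain ⟨Γ, hΓπ, hΓγ⟩ := exists_gluing π γ (hπ.2.trans hγ.1.symm)
  have mπ : MeasurePreserving (fun p : Euc d × Euc d × Euc d => (p.2.1, p.1)) Γ π :=
    ⟨by fun_prop, hΓπ⟩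
  have mγ : MeasurePreserving (fun p : Euc d × Euc d × Euc d => (p.1, p.2.2)) Γ γ :=
    ⟨by fun_prop, hΓγ⟩
  have : IsProbabilityMeasure Γ := mπ.isProbabilityMeasure_domain
  have mx : MeasurePreserving (fun p : Euc d × Euc d × Euc d => p.2.1) Γ μ :=
    (((MeasurePreserving.mk measurable_fst hπ.1).comp mπ) :)
  have my : MeasurePreserving (fun p : Euc d × Euc d × Euc d => p.1) Γ ν :=
    (((MeasurePreserving.mk measurable_fst hγ.1).comp mγ) :)
  have my' : MeasurePreserving (fun p : Euc d × Euc d × Euc d => p.2.2) Γ ν' :=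
    (((MeasurePreserving.mk measurable_snd hγ.2).comp mγ) :)
  have hπ' : IsCoupling (Γ.map (fun p => (p.2.1, p.2.2))) μ ν' := by
    refine ⟨?_, ?_⟩
    · rw [Measure.map_map (by fun_prop) (by fun_prop)]; exact mx.map_eq
    · rw [Measure.map_map (by fun_prop) (by fun_prop)]; exact my'.map_eq
  have mπ' : MeasurePreserving (fun p : Euc d × Euc d × Euc d => (p.2.1, p.2.2)) Γ _ :=
    ⟨by fun_prop, rfl⟩
  have hle := hc.transportCost_le hμ hν' hπ'
  obtain ⟨ic, ec⟩ := mπ.integrable_and_integral_comp (hc.integrable_cost hμ hν hπ)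
  obtain ⟨ic', ec'⟩ := mπ'.integrable_and_integral_comp (hc.integrable_cost hμ hν' hπ')
  obtain ⟨i0, e0⟩ := my.integrable_and_integral_comp (hc.integrable_left hν)
  obtain ⟨i0', e0'⟩ := my'.integrable_and_integral_comp (hc.integrable_left hν')
  obtain ⟨it, et⟩ := mx.integrable_and_integral_comp (g := fun x => max (c x y0 - R₁) 0)
    ((hc.integrable_right hμ).sub (integrable_const R₁)).pos_part
  set D : Set (Euc d × Euc d) := {p | δ ≤ dist p.1 p.2} with hD
  have hDm : MeasurableSet D := (isClosed_le continuous_const continuous_dist).measurableSet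
  obtain ⟨iD, eD⟩ := mγ.integrable_and_integral_comp
    ((integrable_indicator_iff hDm).2 (integrable_const (1 : ℝ)).integrableOn)
  have hDδ : γ.real D ≤ δ := ENNReal.toReal_le_of_le_ofReal hδ0.le hγδ
  have eD' : ∫ p, D.indicator (fun _ => (1 : ℝ)) p ∂γ = γ.real D := by
    rw [integral_indicator hDm]; simp
  set a : ℝ := η + 4 * B * R₁ / R with ha
  have hpt : ∀ᵐ p ∂Γ, (c p.2.1 p.2.2 - c x0 p.2.2) - (c p.2.1 p.1 - c x0 p.1) ≤
      ε / 8 + (a * (c x0 p.1 + c x0 p.2.2) + (4 * B * R₁ * D.indicator (fun _ => (1 : ℝ))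
        (p.1, p.2.2) + 4 * B * max (c p.2.1 y0 - R₁) 0)) := by
    have hx : ∀ᵐ p ∂Γ, p.2.1 ∈ X := mx.quasiMeasurePreserving.ae hμ.2.1
    have hy : ∀ᵐ p ∂Γ, p.1 ∈ Y := my.quasiMeasurePreserving.ae hν.2.1
    have hy' : ∀ᵐ p ∂Γ, p.2.2 ∈ Y := my'.quasiMeasurePreserving.ae hν'.2.1
    filter_upwards [hx, hy, hy'] with ⟨y, x, y'⟩ hx hy hy'
    dsimp only at hx hy hy' ⊢
    have b1 := (hB x hx y hy).1.1
    have b2 := (hB x hx y' hy').1.2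
    have n0 := hc.nonneg x hx y0 hc.y0mem
    have n1 := hc.nonneg x0 hc.x0mem y hy
    have n2 := hc.nonneg x0 hc.x0mem y' hy'
    have hind : 0 ≤ D.indicator (fun _ => (1 : ℝ)) (y, y') := indicator_nonneg (by simp) _
    have hmax := le_max_right (c x y0 - R₁) 0
    have hmax' := le_max_left (c x y0 - R₁) 0
    have hBR : 0 < 4 * B * R₁ := by positivity
    have t2 : 0 ≤ 4 * B * R₁ * D.indicator (fun _ => (1 : ℝ)) (y, y') := by positivity
    have t3 : 0 ≤ 4 * B * max (c x y0 - R₁) 0 := by positivity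
    have q1 : 0 ≤ 4 * B * R₁ / R * c x0 y := by positivity
    have q2 : 0 ≤ 4 * B * R₁ / R * c x0 y' := by positivity
    have q3 : 0 ≤ η * (c x0 y + c x0 y') := by positivity
    have hbase : (c x y' - c x0 y') - (c x y - c x0 y) ≤ η * (c x0 y + c x0 y') +
      2 * B * c x y0 := by linarith
    have hexp : a * (c x0 y + c x0 y') = η * (c x0 y + c x0 y') + 4 * B * R₁ / R * c x0 y +
      4 * B * R₁ / R * c x0 y' := by rw [ha]; ring
    rw [hexp]
    rcases lt_or_ge (2 * R₁) (c x y0) with hg | hg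
    · have : 2 * B * c x y0 ≤ 4 * B * max (c x y0 - R₁) 0 := by nlinarith
      linarith
    · have hg' : 2 * B * c x y0 ≤ 4 * B * R₁ := by nlinarith
      have hlarge : ∀ z, R < c x0 z → 4 * B * R₁ ≤ 4 * B * R₁ / R * c x0 z := by
        intro z hz
        rw [div_mul_eq_mul_div, le_div_iff₀ hR0]
        exact mul_le_mul_of_nonneg_left hz.le hBR.le
      rcases lt_or_ge R (c x0 y) with h1 | h1
      · linarith [hlarge y h1]
      rcases lt_or_ge R (c x0 y') with h2 | h2
      · linarith [hlarge y' h2]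
      rcases le_or_gt δ (dist y y') with h3 | h3
      · rw [indicator_of_mem (show (y, y') ∈ D from h3), mul_one]
        linarith
      · have := huc (x, y') ⟨⟨hx, hg⟩, hy', h2⟩ (x, y) ⟨⟨hx, hg⟩, hy, h1⟩ (by
          rw [Prod.dist_eq, dist_self, max_eq_right dist_nonneg, dist_comm]
          exact h3.trans_le (min_le_left _ _))
        rw [Real.dist_eq] at this
        have := (abs_lt.1 this).2
        dsimp only at this
        linarith
  have j1 : Integrable (fun p => c p.2.1 p.2.2 - c x0 p.2.2) Γ := ic'.sub i0'
  have j2 : Integrable (fun p => c p.2.1 p.1 - c x0 p.1) Γ := ic.sub i0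
  have k0 : Integrable (fun p => c x0 p.1 + c x0 p.2.2) Γ := i0.add i0'
  have k1 : Integrable (fun p => a * (c x0 p.1 + c x0 p.2.2)) Γ := k0.const_mul a
  have k2 : Integrable (fun p : Euc d × Euc d × Euc d =>
      4 * B * R₁ * D.indicator (fun _ => (1 : ℝ)) (p.1, p.2.2)) Γ := iD.const_mul _
  have k3 : Integrable (fun p : Euc d × Euc d × Euc d => 4 * B * max (c p.2.1 y0 - R₁) 0) Γ :=
    it.const_mul _
  have hint := integral_mono_ae (j1.sub j2)
    ((integrable_const (ε / 8)).add (k1.add (k2.add k3))) hpt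
  have hL : ∫ p, ((c p.2.1 p.2.2 - c x0 p.2.2) - (c p.2.1 p.1 - c x0 p.1)) ∂Γ =
      (∫ p, c p.1 p.2 ∂(Γ.map (fun p => (p.2.1, p.2.2))) - ∫ y, c x0 y ∂ν') -
        (∫ p, c p.1 p.2 ∂π - ∫ y, c x0 y ∂ν) := by
    rw [integral_sub j1 j2, integral_sub ic' i0', integral_sub ic i0, ec, ec', e0, e0']
  have hRr : ∫ p, (ε / 8 + (a * (c x0 p.1 + c x0 p.2.2) + (4 * B * R₁ * D.indicator
      (fun _ => (1 : ℝ)) (p.1, p.2.2) + 4 * B * max (c p.2.1 y0 - R₁) 0))) ∂Γ =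
      ε / 8 + (a * (∫ y, c x0 y ∂ν + ∫ y, c x0 y ∂ν') + (4 * B * R₁ * γ.real D +
        4 * B * ∫ x, max (c x y0 - R₁) 0 ∂μ)) := by
    have k4 : Integrable (fun p : Euc d × Euc d × Euc d => 4 * B * R₁ * D.indicator
        (fun _ => (1 : ℝ)) (p.1, p.2.2) + 4 * B * max (c p.2.1 y0 - R₁) 0) Γ := k2.add k3
    have k5 : Integrable (fun p : Euc d × Euc d × Euc d => a * (c x0 p.1 + c x0 p.2.2) +
        (4 * B * R₁ * D.indicator (fun _ => (1 : ℝ)) (p.1, p.2.2) +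
          4 * B * max (c p.2.1 y0 - R₁) 0)) Γ := k1.add k4
    rw [integral_add (integrable_const _) k5, integral_add k1 k4, integral_add k2 k3,
      integral_const_mul, integral_const_mul, integral_const_mul, integral_add i0 i0', e0, e0',
      eD, eD', et, integral_const, probReal_univ, one_smul]
  have hint' := hL.symm.le.trans (hint.trans hRr.le)
  have s1 : a * (∫ y, c x0 y ∂ν + ∫ y, c x0 y ∂ν') ≤ ε / 4 := by
    have ha' : a = ε / (8 * C) := by
      rw [ha, hη, hR]; field_simp; norm_num
    calc a * (∫ y, c x0 y ∂ν + ∫ y, c x0 y ∂ν') ≤ a * (C + C) := by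
          refine mul_le_mul_of_nonneg_left (by linarith) ?_
          rw [ha']; positivity
      _ = ε / 4 := by rw [ha']; field_simp; norm_num
  have s2 : 4 * B * R₁ * γ.real D ≤ ε / 8 := by
    calc 4 * B * R₁ * γ.real D ≤ 4 * B * R₁ * (ε / (32 * B * R₁)) := by
          refine mul_le_mul_of_nonneg_left (hDδ.trans (min_le_right _ _)) (by positivity)
      _ = ε / 8 := by field_simp; norm_num
  have s3 : 4 * B * ∫ x, max (c x y0 - R₁) 0 ∂μ ≤ ε / 8 := by
    calc 4 * B * ∫ x, max (c x y0 - R₁) 0 ∂μ ≤ 4 * B * (ε / (32 * B)) :=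
          mul_le_mul_of_nonneg_left hR₁ (by positivity)
      _ = ε / 8 := by field_simp; norm_num
  linarith

end CostAssumptions

lemma IsCoupling.swap {d : ℕ} {γ : Measure (Euc d × Euc d)} {μ ν : Measure (Euc d)}
    (h : IsCoupling γ μ ν) : IsCoupling (γ.map Prod.swap) ν μ := by
  refine ⟨?_, ?_⟩
  · rw [Measure.map_map measurable_fst measurable_swap]; exact h.2
  · rw [Measure.map_map measurable_snd measurable_swap]; exact h.1

lemma weakLimit_iff_tendsto {d : ℕ} {νs : ℕ → ProbabilityMeasure (Euc d)}
    {ν : ProbabilityMeasure (Euc d)} :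
    WeakLimit (fun n => (νs n : Measure (Euc d))) ν ↔ Tendsto νs atTop (𝓝 ν) :=
  ProbabilityMeasure.tendsto_iff_forall_integral_tendsto.symm

namespace CostAssumptions

variable {d : ℕ} {X Y : Set (Euc d)} {c : Euc d → Euc d → ℝ} {x0 y0 : Euc d}

/-- The excess `K_c(μ, ν) - ∫ c x0 y dν` is weakly continuous on sets of bounded cost integral. -/
lemma tendsto_excess (hc : CostAssumptions d X Y c x0 y0) {μ : Measure (Euc d)}
    (hμ : memPcost (fun x => c x y0) X μ) {νs : ℕ → Measure (Euc d)} {ν : Measure (Euc d)}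
    (hνs : ∀ n, memPcost (fun y => c x0 y) Y (νs n)) (hν : memPcost (fun y => c x0 y) Y ν)
    {C : ℝ} (hC : ∀ n, ∫ y, c x0 y ∂(νs n) ≤ C) (hlim : WeakLimit νs ν) :
    Tendsto (fun n => transportCost c μ (νs n) - ∫ y, c x0 y ∂(νs n)) atTop
      (𝓝 (transportCost c μ ν - ∫ y, c x0 y ∂ν)) := by
  set C' : ℝ := max C (∫ y, c x0 y ∂ν) + 1
  have hM : C < C' := (le_max_left _ _).trans_lt (lt_add_one _)
  have hM' : ∫ y, c x0 y ∂ν < C' := (le_max_right _ _).trans_lt (lt_add_one _)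
  have hC' : 0 < C' := (hc.integral_left_nonneg hν).trans_lt hM'
  let P : ℕ → ProbabilityMeasure (Euc d) := fun n => ⟨νs n, (hνs n).1⟩
  let Q : ProbabilityMeasure (Euc d) := ⟨ν, hν.1⟩
  have hP : Tendsto P atTop (𝓝 Q) := weakLimit_iff_tendsto.1 hlim
  refine Metric.tendsto_nhds.2 fun ε hε => ?_
  obtain ⟨δ, hδ, h⟩ := hc.exists_forall_excess_le hμ hC' (half_pos hε)
  filter_upwards [eventually_exists_coupling _ _ hP hδ] with n ⟨γ, h1, h2, h3⟩
  have hγ : IsCoupling γ ν (νs n) := ⟨h1, h2⟩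
  have u := h ν (νs n) γ hν (hνs n) hM'.le ((hC n).trans hM.le) hγ h3
  have l := h (νs n) ν _ (hνs n) hν ((hC n).trans hM.le) hM'.le hγ.swap (by
    rw [Measure.map_apply measurable_swap
      (isClosed_le continuous_const continuous_dist).measurableSet]
    simpa only [preimage_ofPred_eq, Prod.fst_swap, Prod.snd_swap, dist_comm] using h3)
  rw [Real.dist_eq, abs_lt]
  constructor <;> linarith

/-- The cost `c x0` truncated at height `R`, extended by `R` outside of `Y`. -/
lemma exists_truncation (hc : CostAssumptions d X Y c x0 y0) {R : ℝ} (hR : 0 ≤ R) :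
    ∃ T : BoundedContinuousFunction (Euc d) ℝ, (∀ y ∈ Y, T y = min (c x0 y) R) ∧
      ∀ y ∉ Y, T y = R := by
  classical
  have hK := (hc.compactY R x0 hc.x0mem).isClosed
  set f : Euc d → ℝ := fun y => if y ∈ Y then min (c x0 y) R else R with hf
  have hcont : Continuous f := by
    refine continuous_iff_continuousAt.2 fun y => ?_
    by_cases hy : y ∈ Y
    · have : ContinuousAt (fun y => min (c x0 y) R) y :=
        (hc.continuousOn_left.continuousAt (hc.openY.mem_nhds hy)).min continuousAt_const
      refine this.congr ?_
      filter_upwards [hc.openY.mem_nhds hy] with z hz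
      simp only [hf, if_pos hz]
    · refine (continuousAt_const (y := R)).congr ?_
      filter_upwards [hK.isOpen_compl.mem_nhds (fun h => hy h.1)] with z hz
      by_cases hzY : z ∈ Y
      · have : R < c x0 z := not_le.1 fun h => hz ⟨hzY, h⟩
        simp only [hf, if_pos hzY, min_eq_right this.le]
      · simp only [hf, if_neg hzY]
  refine ⟨BoundedContinuousFunction.ofNormedAddCommGroup f hcont R fun y => ?_,
    fun y hy => by simp [hf, hy], fun y hy => by simp [hf, hy]⟩
  by_cases hy : y ∈ Y
  · have := hc.nonneg x0 hc.x0mem y hy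
    simp only [hf, if_pos hy]
    rw [Real.norm_of_nonneg (le_min this hR)]
    exact min_le_right _ _
  · simp only [hf, if_neg hy, Real.norm_of_nonneg hR, le_refl]

lemma integral_truncation_le (hc : CostAssumptions d X Y c x0 y0) {R : ℝ}
    {T : BoundedContinuousFunction (Euc d) ℝ} (hT : ∀ y ∈ Y, T y = min (c x0 y) R)
    {ν : Measure (Euc d)} (hν : memPcost (fun y => c x0 y) Y ν) :
    ∫ y, T y ∂ν ≤ ∫ y, c x0 y ∂ν := by
  have := hν.1
  have hae : ∀ᵐ y ∂ν, y ∈ Y := hν.2.1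
  refine integral_mono_ae (T.integrable ν) (hc.integrable_left hν) ?_
  filter_upwards [hae] with y hy
  rw [hT y hy]
  exact min_le_left _ _

/-- The cost integral is weakly lower semicontinuous. -/
lemma eventually_integral_left_ge (hc : CostAssumptions d X Y c x0 y0)
    {νs : ℕ → Measure (Euc d)} {ν : Measure (Euc d)}
    (hνs : ∀ n, memPcost (fun y => c x0 y) Y (νs n)) (hν : memPcost (fun y => c x0 y) Y ν)
    (hlim : WeakLimit νs ν) {ε : ℝ} (hε : 0 < ε) :
    ∀ᶠ n in atTop, ∫ y, c x0 y ∂ν - ε ≤ ∫ y, c x0 y ∂(νs n) := by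
  have := hν.1
  have hae : ∀ᵐ y ∂ν, y ∈ Y := hν.2.1
  choose T hT hT' using fun k : ℕ => hc.exists_truncation (k.cast_nonneg (α := ℝ))
  have hk : Tendsto (fun k => ∫ y, T k y ∂ν) atTop (𝓝 (∫ y, c x0 y ∂ν)) := by
    refine tendsto_integral_of_dominated_convergence (fun y => c x0 y)
      (fun k => ((T k).integrable ν).aestronglyMeasurable) (hc.integrable_left hν)
      (fun k => ?_) ?_
    · filter_upwards [hae] with y hy
      rw [hT k y hy, Real.norm_of_nonneg
        (le_min (hc.nonneg x0 hc.x0mem y hy) k.cast_nonneg)]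
      exact min_le_left _ _
    · filter_upwards [hae] with y hy
      refine tendsto_const_nhds.congr' ?_
      obtain ⟨N, hN⟩ := exists_nat_ge (c x0 y)
      filter_upwards [eventually_ge_atTop N] with k hk
      rw [hT k y hy, min_eq_left (hN.trans (by exact_mod_cast hk))]
  obtain ⟨k, hk⟩ := (hk.eventually (lt_mem_nhds
    (show ∫ y, c x0 y ∂ν - ε / 2 < _ by linarith))).exists
  filter_upwards [(hlim (T k)).eventually (lt_mem_nhds
    (show ∫ y, T k y ∂ν - ε / 2 < _ by linarith))]
    with n hn
  linarith [hc.integral_truncation_le (hT k) (hνs n)]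

/-- Weak limits of measures with bounded cost integral lie in `P_cost(Y)`. -/
lemma memPcost_of_weakLimit (hc : CostAssumptions d X Y c x0 y0)
    {νs : ℕ → Measure (Euc d)} {ν : Measure (Euc d)} [IsProbabilityMeasure ν]
    (hνs : ∀ n, memPcost (fun y => c x0 y) Y (νs n)) {C : ℝ}
    (hC : ∀ n, ∫ y, c x0 y ∂(νs n) ≤ C) (hlim : WeakLimit νs ν) :
    memPcost (fun y => c x0 y) Y ν := by
  choose T hT hT' using fun k : ℕ => hc.exists_truncation (k.cast_nonneg (α := ℝ))
  have hT0 : ∀ k y, 0 ≤ T k y := fun k y => by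
    by_cases hy : y ∈ Y
    · rw [hT k y hy]; exact le_min (hc.nonneg x0 hc.x0mem y hy) k.cast_nonneg
    · rw [hT' k y hy]; exact k.cast_nonneg
  have hTC : ∀ k, ∫ y, T k y ∂ν ≤ C := fun k =>
    le_of_tendsto' (hlim (T k)) fun n => (hc.integral_truncation_le (hT k) (hνs n)).trans (hC n)
  have hmono : Monotone fun k y => ENNReal.ofReal (T k y) := fun k l hkl y => by
    have hkl' : (k : ℝ) ≤ l := by exact_mod_cast hkl
    refine ENNReal.ofReal_le_ofReal ?_
    by_cases hy : y ∈ Y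
    · rw [hT k y hy, hT l y hy]; exact min_le_min_left _ hkl'
    · rw [hT' k y hy, hT' l y hy]; exact hkl'
  have hle : ∫⁻ y, ⨆ k, ENNReal.ofReal (T k y) ∂ν ≤ ENNReal.ofReal C := by
    rw [lintegral_iSup (fun k => (T k).continuous.measurable.ennreal_ofReal) hmono]
    refine iSup_le fun k => ?_
    rw [← ofReal_integral_eq_lintegral_ofReal ((T k).integrable ν) (.of_forall (hT0 k))]
    exact ENNReal.ofReal_le_ofReal (hTC k)
  have hfin : ∫⁻ y, ⨆ k, ENNReal.ofReal (T k y) ∂ν ≠ ⊤ :=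
    ne_top_of_le_ne_top ENNReal.ofReal_ne_top hle
  have hae : ∀ᵐ y ∂ν, y ∈ Y := by
    filter_upwards [ae_lt_top (.iSup fun k => (T k).continuous.measurable.ennreal_ofReal) hfin]
      with y hy
    by_contra hyY
    refine hy.ne (ENNReal.eq_top_of_forall_nnreal_le fun r => ?_)
    obtain ⟨k, hk⟩ := exists_nat_ge (r : ℝ)
    refine le_iSup_of_le k ?_
    rw [hT' k y hyY, ← ENNReal.ofReal_coe_nnreal]
    exact ENNReal.ofReal_le_ofReal hk
  refine ⟨inferInstance, hae, lt_of_le_of_lt (lintegral_mono_ae ?_) (lt_top_iff_ne_top.2 hfin)⟩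
  filter_upwards [hae] with y hy
  obtain ⟨k, hk⟩ := exists_nat_ge (c x0 y)
  refine le_iSup_of_le k ?_
  rw [hT k y hy, min_eq_left hk]

/-- Measures in `P_cost(Y)` with bounded cost integral are weakly sequentially precompact. -/
lemma exists_subseq_weakLimit (hc : CostAssumptions d X Y c x0 y0)
    {νs : ℕ → Measure (Euc d)} (hνs : ∀ n, memPcost (fun y => c x0 y) Y (νs n)) {C : ℝ}
    (hC : ∀ n, ∫ y, c x0 y ∂(νs n) ≤ C) :
    ∃ φ : ℕ → ℕ, StrictMono φ ∧ ∃ ν : Measure (Euc d),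
      memPcost (fun y => c x0 y) Y ν ∧ WeakLimit (fun n => νs (φ n)) ν := by
  set P : ℕ → ProbabilityMeasure (Euc d) := fun n => ⟨νs n, (hνs n).1⟩
  have htight : IsTightMeasureSet {x | ∃ μ ∈ range P, (μ : Measure (Euc d)) = x} := by
    refine isTightMeasureSet_iff_exists_isCompact_measure_compl_le.2 fun ε hε => ?_
    obtain ⟨r, hr0, hr⟩ : ∃ r : ℝ, 0 < r ∧ ENNReal.ofReal r ≤ ε := by
      rcases eq_or_ne ε ⊤ with rfl | h
      · exact ⟨1, one_pos, le_top⟩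
      · exact ⟨ε.toReal, ENNReal.toReal_pos hε.ne' h, (ENNReal.ofReal_toReal h).le⟩
    have hR : 0 < (|C| + 1) / r := by positivity
    refine ⟨_, hc.compactY ((|C| + 1) / r) x0 hc.x0mem, ?_⟩
    rintro _ ⟨_, ⟨n, rfl⟩, rfl⟩
    have := (hνs n).1
    have hae : ∀ᵐ y ∂(νs n), y ∈ Y := (hνs n).2.1
    refine le_trans ?_ hr
    have hmarkov := mul_meas_ge_le_integral_of_nonneg (μ := νs n) (f := fun y => c x0 y) (by
      filter_upwards [hae] with y hy using hc.nonneg x0 hc.x0mem y hy)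
      (hc.integrable_left (hνs n)) ((|C| + 1) / r)
    have hle : (νs n) {y ∈ Y | c x0 y ≤ (|C| + 1) / r}ᶜ ≤
        (νs n) {y | (|C| + 1) / r ≤ c x0 y} := by
      refine measure_mono_ae ?_
      filter_upwards [hae] with y hy hyn
      exact (not_le.1 fun h => hyn ⟨hy, h⟩).le
    refine hle.trans ?_
    rw [← ofReal_measureReal]
    refine ENNReal.ofReal_le_ofReal ?_
    have h1 : (|C| + 1) / r * (νs n).real {y | (|C| + 1) / r ≤ c x0 y} ≤ (|C| + 1) / r * r := by
      rw [div_mul_cancel₀ _ hr0.ne']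
      linarith [hC n, le_abs_self C]
    exact le_of_mul_le_mul_left h1 hR
  obtain ⟨ν, -, φ, hφ, hlim⟩ := (isCompact_closure_of_isTightMeasureSet htight).tendsto_subseq
    (fun n => subset_closure (mem_range_self n))
  have hw : WeakLimit (fun n => νs (φ n)) ν :=
    weakLimit_iff_tendsto (νs := P ∘ φ).2 hlim
  exact ⟨φ, hφ, ν, hc.memPcost_of_weakLimit (fun n => hνs (φ n)) (fun n => hC (φ n)) hw, hw⟩

end CostAssumptions

namespace CostAssumptions

variable {d m : ℕ} {X Y : Set (Euc d)} {c : Euc d → Euc d → ℝ} {x0 y0 : Euc d}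
  {a : Fin m → ℝ} {μs : Fin m → Measure (Euc d)}

lemma barycenterFun_eq (hsum : ∑ i, a i = 1) (ν : Measure (Euc d)) :
    barycenterFun c a μs ν = ∫ y, c x0 y ∂ν +
      ∑ i, a i * (transportCost c (μs i) ν - ∫ y, c x0 y ∂ν) := by
  simp only [mul_sub, Finset.sum_sub_distrib, ← Finset.sum_mul, hsum, one_mul, barycenterFun]
  ring

/-- The barycenter functional controls half of the cost integral, up to a constant. -/
lemma exists_integral_left_le_barycenterFun (hc : CostAssumptions d X Y c x0 y0)
    (hsum : ∑ i, a i = 1) (hμs : ∀ i, memPcost (fun x => c x y0) X (μs i)) :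
    ∃ D : ℝ, ∀ ν : Measure (Euc d), memPcost (fun y => c x0 y) Y ν →
      (∫ y, c x0 y ∂ν) / 2 ≤ barycenterFun c a μs ν + D := by
  set A : ℝ := ∑ i, |a i|
  have hA : 1 ≤ A := by
    calc (1 : ℝ) = |∑ i, a i| := by rw [hsum, abs_one]
      _ ≤ A := Finset.abs_sum_le_sum_abs _ _
  obtain ⟨B, -, hB⟩ := hc.growth (1 / (2 * A)) (by positivity)
  refine ⟨∑ i, |a i| * (B * ∫ x, c x y0 ∂(μs i)), fun ν hν => ?_⟩
  rw [barycenterFun_eq (x0 := x0) hsum]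
  have key : ∀ i, -(|a i| * (1 / (2 * A) * ∫ y, c x0 y ∂ν)) - |a i| * (B * ∫ x, c x y0 ∂(μs i)) ≤
      a i * (transportCost c (μs i) ν - ∫ y, c x0 y ∂ν) := fun i => by
    have h := mul_le_mul_of_nonneg_left (hc.abs_transportCost_sub_le (hμs i) hν
      fun x hx y hy => (hB x hx y hy).1) (abs_nonneg (a i))
    rw [← abs_mul] at h
    linarith [neg_abs_le (a i * (transportCost c (μs i) ν - ∫ y, c x0 y ∂ν))]
  have hs := Finset.sum_le_sum fun i (_ : i ∈ Finset.univ) => key i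
  rw [Finset.sum_sub_distrib, Finset.sum_neg_distrib, ← Finset.sum_mul] at hs
  have hhalf : A * (1 / (2 * A) * ∫ y, c x0 y ∂ν) = (∫ y, c x0 y ∂ν) / 2 := by
    field_simp
  linarith

/-- Weak lower semicontinuity of the barycenter functional under bounded cost integral. -/
lemma eventually_barycenterFun_ge (hc : CostAssumptions d X Y c x0 y0)
    (hsum : ∑ i, a i = 1) (hμs : ∀ i, memPcost (fun x => c x y0) X (μs i))
    {νs : ℕ → Measure (Euc d)} {ν : Measure (Euc d)}
    (hνs : ∀ n, memPcost (fun y => c x0 y) Y (νs n)) (hν : memPcost (fun y => c x0 y) Y ν)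
    {C : ℝ} (hC : ∀ n, ∫ y, c x0 y ∂(νs n) ≤ C) (hlim : WeakLimit νs ν) {ε : ℝ} (hε : 0 < ε) :
    ∀ᶠ n in atTop, barycenterFun c a μs ν - ε ≤ barycenterFun c a μs (νs n) := by
  have ht : Tendsto
      (fun n => ∑ i, a i * (transportCost c (μs i) (νs n) - ∫ y, c x0 y ∂(νs n))) atTop
      (𝓝 (∑ i, a i * (transportCost c (μs i) ν - ∫ y, c x0 y ∂ν))) :=
    tendsto_finsetSum _ fun i _ => (hc.tendsto_excess (hμs i) hνs hν hC hlim).const_mul _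
  filter_upwards [ht.eventually (lt_mem_nhds (sub_lt_self _ (half_pos hε))),
    hc.eventually_integral_left_ge hνs hν hlim (half_pos hε)] with n h1 h2
  rw [barycenterFun_eq (x0 := x0) hsum, barycenterFun_eq (x0 := x0) hsum]
  linarith

lemma memPcost_dirac (hc : CostAssumptions d X Y c x0 y0) :
    memPcost (fun y => c x0 y) Y (Measure.dirac y0) := by
  refine ⟨inferInstance, ?_, ?_⟩
  · rw [Measure.dirac_apply' _ hc.openY.measurableSet.compl]
    simp [hc.y0mem]
  · rw [lintegral_dirac]
    exact ENNReal.ofReal_lt_top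

end CostAssumptions

/-- Under assumptions (A1)–(A3), the barycenter functional is coercive over
`P_cost(Y)` (its sublevel sets have uniformly bounded cost integral and are weakly sequentially
precompact with limit points in `P_cost(Y)`), it is sequentially weakly lower semicontinuous on
its sublevel sets, and there exists a signed barycenter minimizing it over `P_cost(Y)`. -/
theorem signed_barycenter_existence {d m : ℕ} (hd : 1 ≤ d) (hm : 1 ≤ m)
    (X Y : Set (Euc d)) (c : Euc d → Euc d → ℝ) (x0 y0 : Euc d)
    (hc : CostAssumptions d X Y c x0 y0)
    (a : Fin m → ℝ) (ha : ∀ i, a i ≠ 0) (hsum : ∑ i, a i = 1)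
    (μs : Fin m → Measure (Euc d)) (hμs : ∀ i, memPcost (fun x => c x y0) X (μs i)) :
    -- coercivity of the barycenter functional over `P_cost(Y)`
    (∀ β : ℝ, ∃ C : ℝ, ∀ ν : Measure (Euc d), memPcost (fun y => c x0 y) Y ν →
        barycenterFun c a μs ν ≤ β → ∫ y, c x0 y ∂ν ≤ C) ∧
    -- the sublevel sets are weakly sequentially precompact with limit points in `P_cost(Y)`
    (∀ β : ℝ, ∀ νs : ℕ → Measure (Euc d),
        (∀ n, memPcost (fun y => c x0 y) Y (νs n) ∧ barycenterFun c a μs (νs n) ≤ β) →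
        ∃ φ : ℕ → ℕ, StrictMono φ ∧ ∃ ν : Measure (Euc d),
          memPcost (fun y => c x0 y) Y ν ∧ WeakLimit (fun n => νs (φ n)) ν) ∧
    -- sequential weak lower semicontinuity on the sublevel sets
    (∀ β : ℝ, ∀ νs : ℕ → Measure (Euc d), ∀ ν : Measure (Euc d),
        (∀ n, memPcost (fun y => c x0 y) Y (νs n) ∧ barycenterFun c a μs (νs n) ≤ β) →
        memPcost (fun y => c x0 y) Y ν → WeakLimit νs ν →
        barycenterFun c a μs ν ≤ liminf (fun n => barycenterFun c a μs (νs n)) atTop) ∧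
    -- existence of a signed barycenter
    (∃ νb : Measure (Euc d), memPcost (fun y => c x0 y) Y νb ∧
        ∀ ν : Measure (Euc d), memPcost (fun y => c x0 y) Y ν →
          barycenterFun c a μs νb ≤ barycenterFun c a μs ν) := by
  obtain ⟨D, hD⟩ := hc.exists_integral_left_le_barycenterFun hsum hμs
  have hcoer : ∀ β : ℝ, ∀ ν : Measure (Euc d), memPcost (fun y => c x0 y) Y ν →
      barycenterFun c a μs ν ≤ β → ∫ y, c x0 y ∂ν ≤ 2 * (β + D) := fun β ν hν hβ => by
    linarith [hD ν hν]
  refine ⟨fun β => ⟨_, hcoer β⟩, fun β νs h => hc.exists_subseq_weakLimit (fun n => (h n).1)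
    fun n => hcoer β _ (h n).1 (h n).2, fun β νs ν h hν hlim => ?_, ?_⟩
  · have hcob : IsCoboundedUnder (· ≥ ·) atTop fun n => barycenterFun c a μs (νs n) :=
      (isBoundedUnder_of ⟨β, fun n => (h n).2⟩ : IsBoundedUnder (· ≤ ·) _ _).isCoboundedUnder_ge
    refine le_of_forall_pos_sub_le fun ε hε => le_liminf_of_le hcob ?_
    exact hc.eventually_barycenterFun_ge hsum hμs (fun n => (h n).1) hν
      (fun n => hcoer β _ (h n).1 (h n).2) hlim hε
  · set S : Set ℝ := barycenterFun c a μs '' {ν | memPcost (fun y => c x0 y) Y ν}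
    have hS : S.Nonempty := ⟨_, _, hc.memPcost_dirac, rfl⟩
    have hbdd : BddBelow S := by
      refine ⟨-D, ?_⟩
      rintro _ ⟨ν, hν, rfl⟩
      linarith [hD ν hν, hc.integral_left_nonneg hν]
    have hex : ∀ n : ℕ, ∃ ν : Measure (Euc d), memPcost (fun y => c x0 y) Y ν ∧
        barycenterFun c a μs ν < sInf S + 1 / ((n : ℝ) + 1) := fun n => by
      obtain ⟨_, ⟨ν, hν, rfl⟩, hlt⟩ := exists_lt_of_csInf_lt hS
        (lt_add_of_pos_right (sInf S) (Nat.one_div_pos_of_nat (α := ℝ) (n := n)))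
      exact ⟨ν, hν, hlt⟩
    choose νs hνs hlt using hex
    have hC : ∀ n, ∫ y, c x0 y ∂(νs n) ≤ 2 * (sInf S + 1 + D) := fun n =>
      hcoer _ _ (hνs n) ((hlt n).le.trans (by
        gcongr
        exact (Nat.one_div_le_one_div n.zero_le).trans (by simp)))
    obtain ⟨φ, hφ, ν, hν, hlim⟩ := hc.exists_subseq_weakLimit hνs hC
    refine ⟨ν, hν, fun ν' hν' => ?_⟩
    refine le_trans ?_ (csInf_le hbdd ⟨ν', hν', rfl⟩)
    refine le_of_forall_pos_le_add fun ε hε => ?_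
    have hsmall : ∀ᶠ n : ℕ in atTop, 1 / ((φ n : ℝ) + 1) < ε / 2 :=
      (tendsto_one_div_add_atTop_nhds_zero_nat.comp hφ.tendsto_atTop).eventually
        (gt_mem_nhds (half_pos hε))
    obtain ⟨n, h1, h2⟩ := ((hc.eventually_barycenterFun_ge hsum hμs (fun n => hνs (φ n)) hν
      (fun n => hC (φ n)) hlim (half_pos hε)).and hsmall).exists
    linarith [hlt (φ n)]

end
end

section
/- Let ε > 0 be such that a_ε := Σ_{i∈I_+} (1−ε)a_i + Σ_{i∈I_−} (1+ε)a_i > 0, and let B_ε > 0 be the constant from assumption (A3) for this ε. Then for every ν ∈ P_cost(Y), B(ν) ≥ a_ε ∫_Y c(x0,y) dν(y) − B_ε Σ_{i=1}^m |a_i| ∫_X c(x,y0) dμ_i(x). -/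
open MeasureTheory Filter Set Topology
open scoped ENNReal BigOperators RealInnerProductSpace

noncomputable section

/-- A function that is continuous on a measurable set of full measure is a.e. measurable. -/
theorem ContinuousOn.aemeasurable_of_measure_compl_eq_zero {α : Type*} [TopologicalSpace α]
    [MeasurableSpace α] [OpensMeasurableSpace α] {f : α → ℝ} {s : Set α} {μ : Measure α}
    (hf : ContinuousOn f s) (hs : MeasurableSet s) (h : μ sᶜ = 0) : AEMeasurable f μ := by
  have := hf.aemeasurable (μ := μ) hs
  rwa [Measure.restrict_eq_self_of_ae_mem (mem_ae_iff.2 h)] at this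

/-- A nonnegative function, continuous on an open set of full measure, with finite lower integral
is integrable. -/
theorem integrable_of_memPcost {d : ℕ} {f : Euc d → ℝ} {S : Set (Euc d)} {μ : Measure (Euc d)}
    (hμ : memPcost f S μ) (hS : IsOpen S) (hf : ContinuousOn f S) (hpos : ∀ x ∈ S, 0 ≤ f x) :
    Integrable f μ := by
  obtain ⟨-, hnull, hfin⟩ := hμ
  have hae : ∀ᵐ x ∂μ, x ∈ S := mem_ae_iff.2 hnull
  exact (lintegral_ofReal_ne_top_iff_integrable
    (hf.aemeasurable_of_measure_compl_eq_zero hS.measurableSet hnull).aestronglyMeasurable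
    (hae.mono hpos)).1 hfin.ne

/-- Integrating two-sided growth bounds on the cost yields two-sided bounds on the optimal
transport cost. -/
theorem transportCost_mem_Icc {d : ℕ} {X Y : Set (Euc d)} {c : Euc d → Euc d → ℝ}
    {f g : Euc d → ℝ} {μ ν : Measure (Euc d)} [IsProbabilityMeasure μ] [IsProbabilityMeasure ν]
    (hX : IsOpen X) (hY : IsOpen Y) (hnonneg : ∀ x ∈ X, ∀ y ∈ Y, 0 ≤ c x y)
    (hcont : ContinuousOn (fun p : Euc d × Euc d => c p.1 p.2) (X ×ˢ Y))
    (hμX : μ Xᶜ = 0) (hνY : ν Yᶜ = 0) (hf : Integrable f μ) (hg : Integrable g ν) {s t B : ℝ}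
    (hlower : ∀ x ∈ X, ∀ y ∈ Y, s * g y - B * f x ≤ c x y)
    (hupper : ∀ x ∈ X, ∀ y ∈ Y, c x y ≤ t * g y + B * f x) :
    transportCost c μ ν ∈
      Set.Icc (s * ∫ y, g y ∂ν - B * ∫ x, f x ∂μ) (t * ∫ y, g y ∂ν + B * ∫ x, f x ∂μ) := by
  have key : ∀ π : Measure (Euc d × Euc d), IsCoupling π μ ν →
      ENNReal.ofReal (s * ∫ y, g y ∂ν - B * ∫ x, f x ∂μ) ≤
        ∫⁻ p, ENNReal.ofReal (c p.1 p.2) ∂π ∧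
      ∫⁻ p, ENNReal.ofReal (c p.1 p.2) ∂π ≤
        ENNReal.ofReal (t * ∫ y, g y ∂ν + B * ∫ x, f x ∂μ) ∧
      0 ≤ t * ∫ y, g y ∂ν + B * ∫ x, f x ∂μ := by
    rintro π ⟨hfst, hsnd⟩
    have mfst : MeasurePreserving Prod.fst π μ := ⟨measurable_fst, hfst⟩
    have msnd : MeasurePreserving Prod.snd π ν := ⟨measurable_snd, hsnd⟩
    have haeX : ∀ᵐ p ∂π, p.1 ∈ X :=
      mfst.quasiMeasurePreserving.ae (p := fun x => x ∈ X) (mem_ae_iff.2 hμX)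
    have haeY : ∀ᵐ p ∂π, p.2 ∈ Y :=
      msnd.quasiMeasurePreserving.ae (p := fun y => y ∈ Y) (mem_ae_iff.2 hνY)
    have hae : ∀ᵐ p ∂π, p ∈ X ×ˢ Y := by
      filter_upwards [haeX, haeY] with p h1 h2 using ⟨h1, h2⟩
    have hf' : Integrable (fun p : Euc d × Euc d => f p.1) π :=
      mfst.integrable_comp_of_integrable hf
    have hg' : Integrable (fun p : Euc d × Euc d => g p.2) π :=
      msnd.integrable_comp_of_integrable hg
    have ef : ∫ p, f p.1 ∂π = ∫ x, f x ∂μ := by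
      rw [← hfst] at hf ⊢
      exact (integral_map measurable_fst.aemeasurable hf.aestronglyMeasurable).symm
    have eg : ∫ p, g p.2 ∂π = ∫ y, g y ∂ν := by
      rw [← hsnd] at hg ⊢
      exact (integral_map measurable_snd.aemeasurable hg.aestronglyMeasurable).symm
    have hpos : 0 ≤ᵐ[π] fun p => c p.1 p.2 :=
      hae.mono fun p hp => hnonneg _ hp.1 _ hp.2
    have hlow : (fun p => s * g p.2 - B * f p.1) ≤ᵐ[π] fun p => c p.1 p.2 :=
      hae.mono fun p hp => hlower _ hp.1 _ hp.2
    have hup : (fun p => c p.1 p.2) ≤ᵐ[π] fun p => t * g p.2 + B * f p.1 :=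
      hae.mono fun p hp => hupper _ hp.1 _ hp.2
    have hmeas : AEMeasurable (fun p : Euc d × Euc d => c p.1 p.2) π :=
      hcont.aemeasurable_of_measure_compl_eq_zero (hX.prod hY).measurableSet (mem_ae_iff.1 hae)
    have hupint := (hg'.const_mul t).add (hf'.const_mul B)
    have hlowint := (hg'.const_mul s).sub (hf'.const_mul B)
    have hint : Integrable (fun p : Euc d × Euc d => c p.1 p.2) π := by
      refine hupint.mono' hmeas.aestronglyMeasurable ?_
      filter_upwards [hpos, hup] with p h1 h2
      rw [Real.norm_eq_abs, abs_of_nonneg h1]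
      exact h2
    rw [← ofReal_integral_eq_lintegral_ofReal hint hpos, ← ef, ← eg, ← integral_const_mul,
      ← integral_const_mul, ← integral_const_mul,
      ← integral_sub (hg'.const_mul s) (hf'.const_mul B),
      ← integral_add (hg'.const_mul t) (hf'.const_mul B)]
    exact ⟨ENNReal.ofReal_le_ofReal (integral_mono_ae hlowint hint hlow),
      ENNReal.ofReal_le_ofReal (integral_mono_ae hint hupint hup),
      integral_nonneg_of_ae (hpos.trans hup)⟩
  have hprod : IsCoupling (μ.prod ν) μ ν := by simp [IsCoupling]
  have hle := (iInf_le (fun π : {π : Measure (Euc d × Euc d) // IsCoupling π μ ν} =>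
    ∫⁻ p, ENNReal.ofReal (c p.1 p.2) ∂π.1) ⟨_, hprod⟩).trans (key _ hprod).2.1
  refine ⟨?_, ENNReal.toReal_le_of_le_ofReal (key _ hprod).2.2 hle⟩
  exact (ENNReal.ofReal_le_iff_le_toReal (ne_top_of_le_ne_top ENNReal.ofReal_ne_top hle)).1
    (le_iInf fun π => (key π.1 π.2).1)

/-- The lower bound for the barycenter functional coming from the growth
assumption (A3): with `a_ε := Σ_{i∈I₊}(1-ε)a_i + Σ_{i∈I₋}(1+ε)a_i > 0` and `B_ε` the constant
from (A3), for every `ν ∈ P_cost(Y)`,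
`B(ν) ≥ a_ε ∫ c(x0,y) dν − B_ε Σ_i |a_i| ∫ c(x,y0) dμ_i`. -/
theorem barycenter_lower_bound {d m : ℕ} (hd : 1 ≤ d) (hm : 1 ≤ m)
    (X Y : Set (Euc d)) (c : Euc d → Euc d → ℝ) (x0 y0 : Euc d)
    (hc : CostAssumptions d X Y c x0 y0)
    (a : Fin m → ℝ) (ha : ∀ i, a i ≠ 0) (hsum : ∑ i, a i = 1)
    (μs : Fin m → Measure (Euc d)) (hμs : ∀ i, memPcost (fun x => c x y0) X (μs i))
    (ε : ℝ) (hε : 0 < ε)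
    (haε : 0 < ∑ i, (if 0 < a i then (1 - ε) * a i else (1 + ε) * a i))
    (Bε : ℝ) (hBε : 0 < Bε)
    (hgrowth : ∀ x ∈ X, ∀ y ∈ Y,
      ((1 - ε) * c x0 y - Bε * c x y0 ≤ c x y ∧ c x y ≤ (1 + ε) * c x0 y + Bε * c x y0) ∧
      ((1 - ε) * c x y0 - Bε * c x0 y ≤ c x y ∧ c x y ≤ (1 + ε) * c x y0 + Bε * c x0 y))
    (ν : Measure (Euc d)) (hν : memPcost (fun y => c x0 y) Y ν) :
    (∑ i, (if 0 < a i then (1 - ε) * a i else (1 + ε) * a i)) * (∫ y, c x0 y ∂ν)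
      - Bε * ∑ i, |a i| * ∫ x, c x y0 ∂(μs i)
      ≤ barycenterFun c a μs ν := by
  have hcont := hc.smooth.continuousOn
  have hg : Integrable (fun y => c x0 y) ν :=
    integrable_of_memPcost hν hc.openY
      (hcont.comp (f := fun y => (x0, y)) (by fun_prop) fun y hy => ⟨hc.x0mem, hy⟩)
      (hc.nonneg x0 hc.x0mem)
  have := hν.1
  have hbound : ∀ i, (if 0 < a i then (1 - ε) * a i else (1 + ε) * a i) * (∫ y, c x0 y ∂ν)
      - Bε * (|a i| * ∫ x, c x y0 ∂(μs i)) ≤ a i * transportCost c (μs i) ν := by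
    intro i
    have hf : Integrable (fun x => c x y0) (μs i) :=
      integrable_of_memPcost (hμs i) hc.openX
        (hcont.comp (f := fun x => (x, y0)) (by fun_prop) fun x hx => ⟨hx, hc.y0mem⟩)
        (fun x hx => hc.nonneg x hx y0 hc.y0mem)
    have := (hμs i).1
    obtain ⟨hlow, hup⟩ := transportCost_mem_Icc hc.openX hc.openY hc.nonneg hcont (hμs i).2.1
      hν.2.1 hf hg (fun x hx y hy => (hgrowth x hx y hy).1.1)
      (fun x hx y hy => (hgrowth x hx y hy).1.2)
    split_ifs with hi
    · rw [abs_of_pos hi]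
      linarith [mul_le_mul_of_nonneg_left hlow hi.le]
    · rw [abs_of_nonpos (not_lt.1 hi)]
      linarith [mul_le_mul_of_nonpos_left hup (not_lt.1 hi)]
  rw [barycenterFun, Finset.sum_mul, Finset.mul_sum, ← Finset.sum_sub_distrib]
  exact Finset.sum_le_sum fun i _ => hbound i

end
end
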